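/- arXiv:2208.06797 — 6 statements merged into one kernel-verified Lean document; each statement's English description precedes it below -/
import Mathlib

section
/- (Cauchy–Schwarz inequality for the 𝒜-2-inner product.) For all x, y, z ∈ E one has ⟨x,y|z⟩·⟨x,y|z⟩* ≤ ⟨x,x|z⟩·⟨y,y|z⟩ in the order of self-adjoint elements of 𝒜. -/
open scoped ComplexOrder

section Characters

variable {A : Type*} [CommCStarAlgebra A] [PartialOrder A] [StarOrderedRing A]

open WeakDual

/-- The order of a commutative C⋆-algebra is detected by its characters. -/
theorem le_of_forall_characterSpace_le {a b : A}
    (h : ∀ φ : characterSpace ℂ A, φ a ≤ φ b) : a ≤ b :=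
  (map_le_map_iff (gelfandStarTransform A)).mp fun φ => h φ

end Characters

theorem Complex.nonneg_of_mul_nonneg_of_pos {a b : ℂ} (ha : 0 < a) (h : 0 ≤ a * b) : 0 ≤ b :=
  le_of_mul_le_mul_left (by rwa [mul_zero]) ha

/- Setting: 𝒜 a commutative unital C*-algebra, E a Hilbert 𝒜-module with
𝒜-valued inner product `ip`, which is 𝒜-linear in the second variable,
conjugate-symmetric, positive and definite, with compatible norm.
The standard 𝒜-2-inner product is ⟨x,y|z⟩ = ip x y * ip z z - ip x z * ip z y. -/
theorem stmt_1
    {𝒜 : Type*} [NormedCommRing 𝒜] [StarRing 𝒜] [CStarRing 𝒜]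
    [NormedAlgebra ℂ 𝒜] [StarModule ℂ 𝒜] [PartialOrder 𝒜] [StarOrderedRing 𝒜]
    [CompleteSpace 𝒜]
    {E : Type*} [NormedAddCommGroup E] [Module 𝒜 E] [CompleteSpace E]
    (ip : E → E → 𝒜)
    (ip_add_right : ∀ x y z : E, ip x (y + z) = ip x y + ip x z)
    (ip_smul_right : ∀ (a : 𝒜) (x y : E), ip x (a • y) = a * ip x y)
    (ip_conj : ∀ x y : E, star (ip x y) = ip y x)
    (ip_smul_left : ∀ (a : 𝒜) (x y : E), ip (a • x) y = star a * ip x y)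
    (ip_nonneg : ∀ x : E, 0 ≤ ip x x)
    (ip_definite : ∀ x : E, ip x x = 0 → x = 0)
    (ip_norm : ∀ x : E, ‖x‖ = Real.sqrt ‖ip x x‖)
    (x y z : E) :
    (ip x y * ip z z - ip x z * ip z y) * star (ip x y * ip z z - ip x z * ip z y) ≤
      (ip x x * ip z z - ip x z * ip z x) * (ip y y * ip z z - ip y z * ip z y) := by
  let _ : CommCStarAlgebra 𝒜 := {}
  have ip_add_left : ∀ x y z : E, ip (x + y) z = ip x z + ip y z := fun x y z => by
    rw [← ip_conj, ip_add_right, star_add, ip_conj, ip_conj]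
  refine le_of_forall_characterSpace_le fun φ => ?_
  have hφ (u : E) : 0 ≤ φ (ip u u) := map_nonneg φ (ip_nonneg u)
  have hexp (a b : 𝒜) (u v : E) : ip (a • u + b • v) (a • u + b • v) =
      star a * a * ip u u + star a * b * ip u v + star b * a * ip v u + star b * b * ip v v := by
    simp only [ip_add_right, ip_add_left, ip_smul_left, ip_smul_right]; ring
  have cs (u v : E) : φ (ip u v) * φ (ip v u) ≤ φ (ip u u) * φ (ip v v) := by
    have hp (p q : E) (hq : 0 < φ (ip q q)) :
        φ (ip p q) * φ (ip q p) ≤ φ (ip p p) * φ (ip q q) := by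
      have h := hφ (ip q q • p + (-ip q p) • q)
      rw [hexp] at h
      simp only [star_neg, ip_conj, map_add, map_mul, map_neg] at h
      refine sub_nonneg.mp (Complex.nonneg_of_mul_nonneg_of_pos hq ?_)
      convert h using 1
      ring
    rcases (hφ v).eq_or_lt with hv | hv
    · rcases (hφ u).eq_or_lt with hu | hu
      · have h := hφ ((1 : 𝒜) • u + (-ip v u) • v)
        rw [hexp] at h
        simp only [star_neg, star_one, ip_conj, map_add, map_mul, map_neg, map_one, ← hu,
          ← hv] at h
        rw [← hu, ← hv, mul_zero]
        have h2 : 0 ≤ (2 : ℂ) * (-(φ (ip u v) * φ (ip v u))) := by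
          convert h using 1
          ring
        exact neg_nonneg.mp (Complex.nonneg_of_mul_nonneg_of_pos two_pos h2)
      · rw [mul_comm, mul_comm (φ (ip u u))]
        exact hp v u hu
    · exact hp u v hv
  simp only [star_sub, star_mul, ip_conj, map_sub, map_mul]
  rcases (hφ z).eq_or_lt with hz | hz
  · have hzero (u : E) : φ (ip u z) * φ (ip z u) = 0 := by
      refine le_antisymm ?_ ?_
      · simpa [← hz] using cs u z
      · rw [← ip_conj u z, map_star]
        exact mul_star_self_nonneg _
    rw [← hz]
    refine le_of_eq ?_
    linear_combination (φ (ip z y) * φ (ip y z) - φ (ip y z) * φ (ip z y)) * hzero x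
  · have h := cs (ip z z • x + (-ip z x) • z) (ip z z • y + (-ip z y) • z)
    simp only [ip_add_right, ip_add_left, ip_smul_left, ip_smul_right, star_neg, ip_conj,
      map_add, map_mul, map_neg] at h
    have hzz : 0 < φ (ip z z) * φ (ip z z) := mul_pos hz hz
    refine sub_nonneg.mp (Complex.nonneg_of_mul_nonneg_of_pos hzz ?_)
    convert sub_nonneg.mpr h using 1
    ring
end

section
/- For all x, y, z ∈ E one has ‖⟨x,y|z⟩‖ ≤ p(x,z)·p(y,z), i.e. ‖⟨x,y|z⟩‖ ≤ ‖⟨x,x|z⟩‖^{1/2}·‖⟨y,y|z⟩‖^{1/2}. -/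
/-- The standard 2-inner product `⟪x, y⟫ ⟪z, z⟫ - ⟪x, z⟫ ⟪z, y⟫` with `z` fixed, as a
positive semidefinite sesquilinear form. -/
@[reducible]
def PreInnerProductSpace.Core.twoInner {𝕜 E : Type*} [RCLike 𝕜] [AddCommGroup E] [Module 𝕜 E]
    (c : PreInnerProductSpace.Core 𝕜 E) (z : E) : PreInnerProductSpace.Core 𝕜 E where
  inner x y := c.inner x y * c.inner z z - c.inner x z * c.inner z y
  conj_inner_symm x y := by
    simp only [map_sub, map_mul, c.conj_inner_symm]
    ring
  re_inner_nonneg x := by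
    have h := InnerProductSpace.Core.inner_mul_inner_self_le (c := c) x z
    have hz : RCLike.im (c.inner z z) = 0 := InnerProductSpace.Core.inner_self_im (c := c) z
    have hn : c.inner x z * c.inner z x = ((‖c.inner x z‖ * ‖c.inner z x‖ : ℝ) : 𝕜) := by
      rw [← c.conj_inner_symm z x, RCLike.mul_conj, RCLike.norm_conj]
      push_cast
      ring
    rw [map_sub, RCLike.mul_re, hz, mul_zero, sub_zero, hn, RCLike.ofReal_re]
    exact sub_nonneg.mpr h
  add_left x y w := by
    simp only [c.add_left]
    ring
  smul_left x y r := by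
    simp only [c.smul_left]
    ring

/-- The Cauchy-Schwarz inequality for a positive semidefinite sesquilinear form. -/
theorem PreInnerProductSpace.Core.norm_inner_le_sqrt_mul_sqrt {𝕜 E : Type*} [RCLike 𝕜]
    [AddCommGroup E] [Module 𝕜 E] (c : PreInnerProductSpace.Core 𝕜 E) (x y : E) :
    ‖c.inner x y‖ ≤ √‖c.inner x x‖ * √‖c.inner y y‖ := by
  have h := InnerProductSpace.Core.inner_mul_inner_self_le (c := c) x y
  have hs : ‖c.inner y x‖ = ‖c.inner x y‖ := by
    rw [← c.conj_inner_symm, RCLike.norm_conj]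
  rw [← Real.sqrt_mul (norm_nonneg _)]
  refine Real.le_sqrt_of_sq_le ?_
  calc ‖c.inner x y‖ ^ 2 = ‖c.inner x y‖ * ‖c.inner y x‖ := by rw [hs, sq]
    _ ≤ RCLike.re (c.inner x x) * RCLike.re (c.inner y y) := h
    _ ≤ ‖c.inner x x‖ * ‖c.inner y y‖ :=
      mul_le_mul (RCLike.re_le_norm _) (RCLike.re_le_norm _) (c.re_inner_nonneg y) (norm_nonneg _)

/-- In a commutative C⋆-algebra the norm is determined by the characters. -/
theorem CommCStarAlgebra.norm_le_of_forall_character {A : Type*} [CommCStarAlgebra A] {a : A}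
    {C : ℝ} (hC : 0 ≤ C) (h : ∀ φ : WeakDual.characterSpace ℂ A, ‖φ a‖ ≤ C) : ‖a‖ ≤ C := by
  rw [← (gelfandTransform_isometry A).norm_map_of_map_zero (map_zero _) a]
  exact (ContinuousMap.norm_le _ hC).mpr h

/-- Characters of a commutative C⋆-algebra are contractive. -/
theorem CommCStarAlgebra.norm_character_apply_le {A : Type*} [CommCStarAlgebra A]
    (φ : WeakDual.characterSpace ℂ A) (a : A) : ‖φ a‖ ≤ ‖a‖ := by
  rw [← (gelfandTransform_isometry A).norm_map_of_map_zero (map_zero _) a]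
  exact ContinuousMap.norm_coe_le_norm (WeakDual.gelfandTransform ℂ A a) φ

open scoped ComplexOrder in
/-- Composing a semidefinite inner product valued in a commutative C⋆-algebra with a character. -/
@[reducible]
noncomputable def PreInnerProductSpace.Core.ofCharacter {A : Type*} [CommCStarAlgebra A]
    [PartialOrder A] [StarOrderedRing A] {E : Type*} [AddCommGroup E] [Module A E] [Module ℂ E]
    [IsScalarTower ℂ A E] (ip : E → E → A)
    (ip_add_right : ∀ x y z : E, ip x (y + z) = ip x y + ip x z)
    (ip_conj : ∀ x y : E, star (ip x y) = ip y x)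
    (ip_smul_left : ∀ (a : A) (x y : E), ip (a • x) y = star a * ip x y)
    (ip_nonneg : ∀ x : E, 0 ≤ ip x x) (φ : WeakDual.characterSpace ℂ A) :
    PreInnerProductSpace.Core ℂ E where
  inner x y := φ (ip x y)
  conj_inner_symm x y := by
    rw [← ip_conj y x, map_star]
    rfl
  re_inner_nonneg x := (Complex.nonneg_iff.mp (map_nonneg φ (ip_nonneg x))).1
  add_left x y z := by
    rw [← ip_conj z, ip_add_right, star_add, ip_conj, ip_conj, map_add]
  smul_left x y r := by
    rw [← algebraMap_smul A r x, ip_smul_left, map_mul, map_star, AlgHomClass.commutes]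
    rfl

/-- The Cauchy-Schwarz inequality for the standard 2-inner product of a semidefinite inner product
valued in a commutative C⋆-algebra. -/
theorem CommCStarAlgebra.norm_twoInner_le {A : Type*} [CommCStarAlgebra A] [PartialOrder A]
    [StarOrderedRing A] {E : Type*} [AddCommGroup E] [Module A E] (ip : E → E → A)
    (ip_add_right : ∀ x y z : E, ip x (y + z) = ip x y + ip x z)
    (ip_conj : ∀ x y : E, star (ip x y) = ip y x)
    (ip_smul_left : ∀ (a : A) (x y : E), ip (a • x) y = star a * ip x y)
    (ip_nonneg : ∀ x : E, 0 ≤ ip x x) (x y z : E) :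
    ‖ip x y * ip z z - ip x z * ip z y‖ ≤
      √‖ip x x * ip z z - ip x z * ip z x‖ * √‖ip y y * ip z z - ip y z * ip z y‖ := by
  let : Module ℂ E := Module.compHom E (algebraMap ℂ A)
  have : IsScalarTower ℂ A E := IsScalarTower.of_algebraMap_smul fun _ _ => rfl
  refine norm_le_of_forall_character (by positivity) fun φ => ?_
  have h : ‖φ (ip x y) * φ (ip z z) - φ (ip x z) * φ (ip z y)‖ ≤
      √‖φ (ip x x) * φ (ip z z) - φ (ip x z) * φ (ip z x)‖ *
        √‖φ (ip y y) * φ (ip z z) - φ (ip y z) * φ (ip z y)‖ :=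
    ((PreInnerProductSpace.Core.ofCharacter ip ip_add_right ip_conj ip_smul_left
      ip_nonneg φ).twoInner z).norm_inner_le_sqrt_mul_sqrt x y
  simp only [← map_mul, ← map_sub] at h
  exact h.trans (mul_le_mul (Real.sqrt_le_sqrt (norm_character_apply_le φ _))
    (Real.sqrt_le_sqrt (norm_character_apply_le φ _)) (Real.sqrt_nonneg _) (Real.sqrt_nonneg _))

/- Setting: 𝒜 a commutative unital C*-algebra, E a Hilbert 𝒜-module with
𝒜-valued inner product `ip`, which is 𝒜-linear in the second variable,
conjugate-symmetric, positive and definite, with compatible norm.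
The standard 𝒜-2-inner product is ⟨x,y|z⟩ = ip x y * ip z z - ip x z * ip z y. -/
theorem stmt_2
    {𝒜 : Type*} [NormedCommRing 𝒜] [StarRing 𝒜] [CStarRing 𝒜]
    [NormedAlgebra ℂ 𝒜] [StarModule ℂ 𝒜] [PartialOrder 𝒜] [StarOrderedRing 𝒜]
    [CompleteSpace 𝒜]
    {E : Type*} [NormedAddCommGroup E] [Module 𝒜 E] [CompleteSpace E]
    (ip : E → E → 𝒜)
    (ip_add_right : ∀ x y z : E, ip x (y + z) = ip x y + ip x z)
    (ip_smul_right : ∀ (a : 𝒜) (x y : E), ip x (a • y) = a * ip x y)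
    (ip_conj : ∀ x y : E, star (ip x y) = ip y x)
    (ip_smul_left : ∀ (a : 𝒜) (x y : E), ip (a • x) y = star a * ip x y)
    (ip_nonneg : ∀ x : E, 0 ≤ ip x x)
    (ip_definite : ∀ x : E, ip x x = 0 → x = 0)
    (ip_norm : ∀ x : E, ‖x‖ = Real.sqrt ‖ip x x‖)
    (x y z : E) :
    ‖ip x y * ip z z - ip x z * ip z y‖ ≤
      Real.sqrt ‖ip x x * ip z z - ip x z * ip z x‖ *
        Real.sqrt ‖ip y y * ip z z - ip y z * ip z y‖ := by
  let : CommCStarAlgebra 𝒜 := { }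
  exact CommCStarAlgebra.norm_twoInner_le ip ip_add_right ip_conj ip_smul_left ip_nonneg x y z
end

section
/- Let x, y ∈ E with ⟨x,x|y⟩ ≠ 0. Then p(x,y) is the greatest element of the set {‖⟨x,z|y⟩‖ : z ∈ E, p(z,y) = 1} ⊆ ℝ; that is, ‖⟨x,z|y⟩‖ ≤ p(x,y) for every z ∈ E with p(z,y) = 1, and there exists z ∈ E with p(z,y) = 1 and ‖⟨x,z|y⟩‖ = p(x,y) (namely z = p(x,y)^{-1}·x). In particular p(x,y) = sup{‖⟨x,z|y⟩‖ : p(z,y) = 1}. -/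
open WeakDual in
lemma norm_le_of_forall_characterSpace {A : Type*} [CommCStarAlgebra A] {a : A} {r : ℝ}
    (hr : 0 ≤ r) (h : ∀ φ : characterSpace ℂ A, ‖φ a‖ ≤ r) : ‖a‖ ≤ r := by
  rw [← (gelfandTransform_isometry A).norm_map_of_map_zero (map_zero _) a,
    ContinuousMap.norm_le _ hr]
  exact h

open WeakDual in
lemma norm_apply_le_of_characterSpace {A : Type*} [CommCStarAlgebra A]
    (φ : characterSpace ℂ A) (a : A) : ‖φ a‖ ≤ ‖a‖ := by
  rw [← (gelfandTransform_isometry A).norm_map_of_map_zero (map_zero _) a]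
  exact (gelfandTransform ℂ A a).norm_coe_le_norm φ

open WeakDual ComplexOrder in
/-- The Cauchy-Schwarz inequality for a module-valued inner product, evaluated at a character. -/
lemma norm_character_sq_le {A E : Type*} [CommCStarAlgebra A] [PartialOrder A] [StarOrderedRing A]
    [AddCommGroup E] [Module A E] (ip : E → E → A)
    (ip_add_right : ∀ x y z : E, ip x (y + z) = ip x y + ip x z)
    (ip_conj : ∀ x y : E, star (ip x y) = ip y x)
    (ip_smul_left : ∀ (a : A) (x y : E), ip (a • x) y = star a * ip x y)
    (ip_nonneg : ∀ x : E, 0 ≤ ip x x) (φ : characterSpace ℂ A) (x y : E) :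
    ‖φ (ip x y)‖ ^ 2 ≤ ‖φ (ip x x)‖ * ‖φ (ip y y)‖ := by
  let : Module ℂ E := Module.compHom E (algebraMap ℂ A)
  have conj (u v : E) : star (φ (ip u v)) = φ (ip v u) := by rw [← map_star, ip_conj]
  have nonneg (u : E) : 0 ≤ φ (ip u u) := map_nonneg φ (ip_nonneg u)
  let core : PreInnerProductSpace.Core ℂ E :=
    { inner := fun u v => φ (ip u v)
      conj_inner_symm := fun u v => conj v u
      re_inner_nonneg := fun u => (Complex.nonneg_iff.mp (nonneg u)).1
      add_left := fun u v w => by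
        rw [← ip_conj, ip_add_right, star_add, ip_conj, ip_conj, map_add]
      smul_left := fun u v r => by
        change φ (ip (algebraMap ℂ A r • u) v) = _
        rw [ip_smul_left, map_mul, map_star, AlgHomClass.commutes]
        rfl }
  have h := InnerProductSpace.Core.inner_mul_inner_self_le (𝕜 := ℂ) x y
  change ‖φ (ip x y)‖ * ‖φ (ip y x)‖ ≤ (φ (ip x x)).re * (φ (ip y y)).re at h
  rw [← conj x y, norm_star, ← sq] at h
  exact h.trans (mul_le_mul (Complex.re_le_norm _) (Complex.re_le_norm _)
    (Complex.nonneg_iff.mp (nonneg y)).1 (norm_nonneg _))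

/-- The Cauchy-Schwarz inequality for the standard 2-inner product. -/
lemma norm_twoInner_sq_le {A E : Type*} [CommCStarAlgebra A] [PartialOrder A] [StarOrderedRing A]
    [AddCommGroup E] [Module A E] (ip : E → E → A)
    (ip_add_right : ∀ x y z : E, ip x (y + z) = ip x y + ip x z)
    (ip_smul_right : ∀ (a : A) (x y : E), ip x (a • y) = a * ip x y)
    (ip_conj : ∀ x y : E, star (ip x y) = ip y x)
    (ip_smul_left : ∀ (a : A) (x y : E), ip (a • x) y = star a * ip x y)
    (ip_nonneg : ∀ x : E, 0 ≤ ip x x) (x z y : E) :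
    ‖ip x z * ip y y - ip x y * ip y z‖ ^ 2 ≤
      ‖ip x x * ip y y - ip x y * ip y x‖ * ‖ip z z * ip y y - ip z y * ip y z‖ := by
  have add_left (u v w : E) : ip (u + v) w = ip u w + ip v w := by
    rw [← ip_conj, ip_add_right, star_add, ip_conj, ip_conj]
  have key (u v : E) : ip (ip y y • u + (-ip y u) • y) (ip y y • v + (-ip y v) • y) =
      ip y y * (ip u v * ip y y - ip u y * ip y v) := by
    simp only [add_left, ip_add_right, ip_smul_left, ip_smul_right, star_neg, ip_conj]
    ring
  have cs := norm_character_sq_le ip ip_add_right ip_conj ip_smul_left ip_nonneg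
  refine (Real.le_sqrt (norm_nonneg _) (by positivity)).mp
    (norm_le_of_forall_characterSpace (Real.sqrt_nonneg _) fun φ => ?_)
  refine Real.le_sqrt_of_sq_le (le_trans ?_
    (mul_le_mul (norm_apply_le_of_characterSpace φ _) (norm_apply_le_of_characterSpace φ _)
      (norm_nonneg _) (norm_nonneg _)))
  rcases eq_or_ne (φ (ip y y)) 0 with hy | hy
  · have hxy : φ (ip x y) = 0 := by simpa [hy, sq_nonpos_iff] using cs φ x y
    rw [map_sub, map_mul, map_mul, hy, hxy]
    simp only [mul_zero, zero_mul, sub_zero, norm_zero, ne_eq, OfNat.ofNat_ne_zero,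
      not_false_eq_true, zero_pow]
    positivity
  · have h := cs φ (ip y y • x + (-ip y x) • y) (ip y y • z + (-ip y z) • y)
    rw [key, key, key] at h
    simp only [map_mul φ (ip y y), norm_mul] at h
    have hpos : 0 < ‖φ (ip y y)‖ ^ 2 := by positivity
    refine le_of_mul_le_mul_left ?_ hpos
    linarith

/- Setting: 𝒜 a commutative unital C*-algebra, E a Hilbert 𝒜-module with
𝒜-valued inner product `ip`, which is 𝒜-linear in the second variable,
conjugate-symmetric, positive and definite, with compatible norm.
The standard 𝒜-2-inner product is ⟨x,y|z⟩ = ip x y * ip z z - ip x z * ip z y. -/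
theorem stmt_3
    {𝒜 : Type*} [NormedCommRing 𝒜] [StarRing 𝒜] [CStarRing 𝒜]
    [NormedAlgebra ℂ 𝒜] [StarModule ℂ 𝒜] [PartialOrder 𝒜] [StarOrderedRing 𝒜]
    [CompleteSpace 𝒜]
    {E : Type*} [NormedAddCommGroup E] [Module 𝒜 E] [CompleteSpace E]
    (ip : E → E → 𝒜)
    (ip_add_right : ∀ x y z : E, ip x (y + z) = ip x y + ip x z)
    (ip_smul_right : ∀ (a : 𝒜) (x y : E), ip x (a • y) = a * ip x y)
    (ip_conj : ∀ x y : E, star (ip x y) = ip y x)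
    (ip_smul_left : ∀ (a : 𝒜) (x y : E), ip (a • x) y = star a * ip x y)
    (ip_nonneg : ∀ x : E, 0 ≤ ip x x)
    (ip_definite : ∀ x : E, ip x x = 0 → x = 0)
    (ip_norm : ∀ x : E, ‖x‖ = Real.sqrt ‖ip x x‖)
    (x y : E) (hxy : ip x x * ip y y - ip x y * ip y x ≠ 0) :
    IsGreatest
      {r : ℝ | ∃ z : E, Real.sqrt ‖ip z z * ip y y - ip z y * ip y z‖ = 1 ∧
        r = ‖ip x z * ip y y - ip x y * ip y z‖}
      (Real.sqrt ‖ip x x * ip y y - ip x y * ip y x‖) ∧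
    Real.sqrt ‖ip x x * ip y y - ip x y * ip y x‖ =
      sSup {r : ℝ | ∃ z : E, Real.sqrt ‖ip z z * ip y y - ip z y * ip y z‖ = 1 ∧
        r = ‖ip x z * ip y y - ip x y * ip y z‖} := by
  let : CommCStarAlgebra 𝒜 := {}
  have smul_left (a : 𝒜) (u v : E) : ip (a • u) v * ip y y - ip (a • u) y * ip y v =
      star a * (ip u v * ip y y - ip u y * ip y v) := by
    rw [ip_smul_left, ip_smul_left]; ring
  have smul_right (a : 𝒜) (u v : E) : ip u (a • v) * ip y y - ip u y * ip y (a • v) =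
      a * (ip u v * ip y y - ip u y * ip y v) := by
    rw [ip_smul_right, ip_smul_right]; ring
  have greatest : IsGreatest
      {r : ℝ | ∃ z : E, Real.sqrt ‖ip z z * ip y y - ip z y * ip y z‖ = 1 ∧
        r = ‖ip x z * ip y y - ip x y * ip y z‖}
      (Real.sqrt ‖ip x x * ip y y - ip x y * ip y x‖) := by
    constructor
    · have hN := norm_pos_iff.mpr hxy
      set N := ‖ip x x * ip y y - ip x y * ip y x‖ with hN_def
      have hp : 0 < √N := Real.sqrt_pos.mpr hN
      have hsq : √N * √N = N := Real.mul_self_sqrt hN.le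
      have norm_scale (b : 𝒜) : ‖algebraMap ℂ 𝒜 ((√N)⁻¹ : ℝ) * b‖ = (√N)⁻¹ * ‖b‖ := by
        rw [← Algebra.smul_def, norm_smul, Complex.norm_real, Real.norm_of_nonneg (by positivity)]
      refine ⟨algebraMap ℂ 𝒜 ((√N)⁻¹ : ℝ) • x, ?_, ?_⟩
      · rw [smul_left, smul_right, ← algebraMap_star_comm, Complex.star_def, Complex.conj_ofReal,
          norm_scale, norm_scale, ← hN_def, Real.sqrt_eq_one]
        field_simp
        linarith
      · rw [smul_right, norm_scale, ← hN_def]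
        field_simp
        linarith
    · rintro r ⟨z, hz, rfl⟩
      refine Real.le_sqrt_of_sq_le ?_
      have h := norm_twoInner_sq_le ip ip_add_right ip_smul_right ip_conj ip_smul_left ip_nonneg
        x z y
      rwa [Real.sqrt_eq_one.mp hz, mul_one] at h
  exact ⟨greatest, greatest.csSup_eq.symm⟩
end

section
/- Let (x_i)_{i∈ℕ} be a frame for E with bounds 0 < A₀ ≤ B₀, and let ξ ∈ E be such that ⟨ξ,ξ⟩ is invertible in 𝒜. Then (x_i) is an 𝒜-2-frame associated to ξ: for every x ∈ E the series Σ_i ⟨x,x_i|ξ⟩⟨x_i,x|ξ⟩ converges in 𝒜, and there exist real numbers 0 < C ≤ D (one may take C = A₀·‖⟨ξ,ξ⟩^{-1}‖^{-1} and D = B₀·‖⟨ξ,ξ⟩‖) such that C·⟨x,x|ξ⟩ ≤ Σ_i ⟨x,x_i|ξ⟩⟨x_i,x|ξ⟩ ≤ D·⟨x,x|ξ⟩ for all x ∈ E. -/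
section

variable {A : Type*} [CommCStarAlgebra A] [PartialOrder A] [StarOrderedRing A]

lemma mul_le_norm_smul_of_nonneg {a t : A} (ha : 0 ≤ a) (ht : 0 ≤ t) : a * t ≤ ‖a‖ • t := by
  have h := Commute.mul_nonneg
    (sub_nonneg.2 (ha.isSelfAdjoint.le_algebraMap_norm_self)) ht (Commute.all _ _)
  rwa [sub_mul, sub_nonneg, ← Algebra.smul_def] at h

/-- If `u * t` is nonnegative for a nonnegative unit `u`, then `t` is bounded above by a multiple
of `u * t`, and `u * t` by a multiple of `t`. -/
lemma Units.le_norm_inv_smul_mul_and_mul_le_norm_smul (u : Aˣ) {t : A} (hu : 0 ≤ (u : A))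
    (ht : 0 ≤ u * t) :
    0 ≤ t ∧ t ≤ ‖(↑u⁻¹ : A)‖ • (u * t) ∧ u * t ≤ ‖(u : A)‖ • t := by
  have hinv : (0 : A) ≤ ↑u⁻¹ := CFC.inv_nonneg_of_nonneg u hu
  have h0 : 0 ≤ t := by simpa using Commute.mul_nonneg hinv ht (Commute.all _ _)
  exact ⟨h0, by simpa using mul_le_norm_smul_of_nonneg hinv ht, mul_le_norm_smul_of_nonneg hu h0⟩

end

/- Setting: 𝒜 a commutative unital C*-algebra, E a Hilbert 𝒜-module with
𝒜-valued inner product `ip`, which is 𝒜-linear in the second variable,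
conjugate-symmetric, positive and definite, with compatible norm.
The standard 𝒜-2-inner product is ⟨x,y|z⟩ = ip x y * ip z z - ip x z * ip z y. -/
theorem stmt_6
    {𝒜 : Type*} [NormedCommRing 𝒜] [StarRing 𝒜] [CStarRing 𝒜]
    [NormedAlgebra ℂ 𝒜] [StarModule ℂ 𝒜] [PartialOrder 𝒜] [StarOrderedRing 𝒜]
    [CompleteSpace 𝒜]
    {E : Type*} [NormedAddCommGroup E] [Module 𝒜 E] [CompleteSpace E]
    (ip : E → E → 𝒜)
    (ip_add_right : ∀ x y z : E, ip x (y + z) = ip x y + ip x z)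
    (ip_smul_right : ∀ (a : 𝒜) (x y : E), ip x (a • y) = a * ip x y)
    (ip_conj : ∀ x y : E, star (ip x y) = ip y x)
    (ip_smul_left : ∀ (a : 𝒜) (x y : E), ip (a • x) y = star a * ip x y)
    (ip_nonneg : ∀ x : E, 0 ≤ ip x x)
    (ip_definite : ∀ x : E, ip x x = 0 → x = 0)
    (ip_norm : ∀ x : E, ‖x‖ = Real.sqrt ‖ip x x‖)
    (f : ℕ → E) (A₀ B₀ : ℝ) (hA₀ : 0 < A₀) (hA₀B₀ : A₀ ≤ B₀)
    (hframe : ∀ x : E, ∃ s : 𝒜, HasSum (fun i => ip x (f i) * ip (f i) x) s ∧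
      A₀ • ip x x ≤ s ∧ s ≤ B₀ • ip x x)
    (ξ : E) (hξ : IsUnit (ip ξ ξ)) :
    ∃ C D : ℝ, 0 < C ∧ C ≤ D ∧
      ∀ x : E, ∃ s : 𝒜,
        HasSum (fun i =>
          (ip x (f i) * ip ξ ξ - ip x ξ * ip ξ (f i)) *
            (ip (f i) x * ip ξ ξ - ip (f i) ξ * ip ξ x)) s ∧
        C • (ip x x * ip ξ ξ - ip x ξ * ip ξ x) ≤ s ∧
        s ≤ D • (ip x x * ip ξ ξ - ip x ξ * ip ξ x) := by
  let _ : CommCStarAlgebra 𝒜 := {}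
  obtain ⟨g, hg⟩ := hξ
  have hk : 0 < ‖(↑g⁻¹ : 𝒜)‖ + 1 := by positivity
  refine ⟨A₀ / (‖(↑g⁻¹ : 𝒜)‖ + 1), max (A₀ / (‖(↑g⁻¹ : 𝒜)‖ + 1)) (B₀ * ‖(g : 𝒜)‖),
    by positivity, le_max_left _ _, fun x => ?_⟩
  have ip_add_left (x y z : E) : ip (x + y) z = ip x z + ip y z := by
    rw [← ip_conj, ip_add_right, star_add, ip_conj, ip_conj]
  -- `y` is a multiple by `ip ξ ξ` of the component of `x` orthogonal to `ξ`
  set y : E := ip ξ ξ • x + (-ip ξ x) • ξ with hy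
  have left (z : E) : ip y z = ip x z * ip ξ ξ - ip x ξ * ip ξ z := by
    rw [hy, ip_add_left, ip_smul_left, ip_smul_left, star_neg, ip_conj, ip_conj]
    ring
  have right (z : E) : ip z y = ip z x * ip ξ ξ - ip z ξ * ip ξ x := by
    rw [hy, ip_add_right, ip_smul_right, ip_smul_right]
    ring
  set t : 𝒜 := ip x x * ip ξ ξ - ip x ξ * ip ξ x with ht
  have hyy : ip y y = g * t := by
    rw [right, left, left, hg, ht]
    ring
  have hg0 : 0 ≤ (g : 𝒜) := hg ▸ ip_nonneg ξ
  obtain ⟨ht0, hlow, hup⟩ :=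
    g.le_norm_inv_smul_mul_and_mul_le_norm_smul hg0 (hyy ▸ ip_nonneg y)
  obtain ⟨s, hs, hAs, hsB⟩ := hframe y
  simp only [left, right] at hs
  rw [hyy] at hAs hsB
  refine ⟨s, hs, le_trans ?_ hAs, hsB.trans ?_⟩
  · calc (A₀ / (‖(↑g⁻¹ : 𝒜)‖ + 1)) • t
        ≤ (A₀ / (‖(↑g⁻¹ : 𝒜)‖ + 1)) • ((‖(↑g⁻¹ : 𝒜)‖ + 1) • (g * t)) := by
          refine smul_le_smul_of_nonneg_left (hlow.trans ?_) (by positivity)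
          exact smul_le_smul_of_nonneg_right (by linarith) (hyy ▸ ip_nonneg y)
      _ = A₀ • (g * t) := by rw [smul_smul, div_mul_cancel₀ _ hk.ne']
  · calc B₀ • (g * t) ≤ B₀ • (‖(g : 𝒜)‖ • t) :=
          smul_le_smul_of_nonneg_left hup (hA₀.le.trans hA₀B₀)
      _ = (B₀ * ‖(g : 𝒜)‖) • t := smul_smul _ _ _
      _ ≤ _ := smul_le_smul_of_nonneg_right (le_max_right _ _) ht0
end

section
/- Let ξ ∈ E be such that ⟨ξ,ξ⟩ is invertible in 𝒜, and let (x_i)_{i∈ℕ} be an 𝒜-2-frame associated to ξ with bounds 0 < A ≤ B. Then (x_i) is a frame for the orthogonal complement of ξ: there exist real numbers 0 < C ≤ D such that for every x ∈ E with ⟨ξ,x⟩ = 0, the series Σ_i ⟨x,x_i⟩⟨x_i,x⟩ converges in 𝒜 and C·⟨x,x⟩ ≤ Σ_i ⟨x,x_i⟩⟨x_i,x⟩ ≤ D·⟨x,x⟩. -/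
/-- The inverse of a strictly positive element of a commutative C⋆-algebra lies between two
positive real multiples of the identity. -/
theorem inverse_bounds_of_nonneg {A : Type*} [CommCStarAlgebra A] [PartialOrder A]
    [StarOrderedRing A] {u v : A} (hu : 0 ≤ u) (huv : u * v = 1) :
    0 ≤ v ∧ (‖u‖ + 1)⁻¹ • (1 : A) ≤ v ∧ v ≤ ‖v‖ • (1 : A) := by
  have hus : star u = u := (IsSelfAdjoint.of_nonneg hu).star_eq
  have hvs : star v = v := by
    have h : star v * u = 1 := by
      have h := congrArg star huv
      rwa [star_mul, hus, star_one] at h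
    calc star v = star v * (u * v) := by rw [huv, mul_one]
      _ = v := by rw [← mul_assoc, h, one_mul]
  have hv : 0 ≤ v := by
    have h : 0 ≤ star v * u * v := star_left_conjugate_nonneg hu v
    rwa [hvs, mul_assoc, huv, mul_one] at h
  have hu_le : u ≤ (‖u‖ + 1) • (1 : A) := by
    have h := IsSelfAdjoint.le_algebraMap_norm_self (a := u) hus
    rw [Algebra.algebraMap_eq_smul_one] at h
    have h1 : (0 : A) ≤ 1 := zero_le_one
    rw [add_smul, one_smul]
    exact h.trans (le_add_of_nonneg_right h1)
  refine ⟨hv, ?_, ?_⟩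
  · have h := Commute.mul_nonneg (sub_nonneg.2 hu_le) hv (Commute.all _ _)
    rw [sub_mul, huv, smul_mul_assoc, one_mul, sub_nonneg] at h
    have hpos : 0 < ‖u‖ + 1 := by positivity
    calc (‖u‖ + 1)⁻¹ • (1 : A) ≤ (‖u‖ + 1)⁻¹ • ((‖u‖ + 1) • v) :=
          smul_le_smul_of_nonneg_left h (by positivity)
      _ = v := inv_smul_smul₀ hpos.ne' v
  · have h := IsSelfAdjoint.le_algebraMap_norm_self (a := v) hvs
    rwa [Algebra.algebraMap_eq_smul_one] at h

/- Setting: 𝒜 a commutative unital C*-algebra, E a Hilbert 𝒜-module with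
𝒜-valued inner product `ip`, which is 𝒜-linear in the second variable,
conjugate-symmetric, positive and definite, with compatible norm.
The standard 𝒜-2-inner product is ⟨x,y|z⟩ = ip x y * ip z z - ip x z * ip z y. -/
theorem stmt_7
    {𝒜 : Type*} [NormedCommRing 𝒜] [StarRing 𝒜] [CStarRing 𝒜]
    [NormedAlgebra ℂ 𝒜] [StarModule ℂ 𝒜] [PartialOrder 𝒜] [StarOrderedRing 𝒜]
    [CompleteSpace 𝒜]
    {E : Type*} [NormedAddCommGroup E] [Module 𝒜 E] [CompleteSpace E]
    (ip : E → E → 𝒜)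
    (ip_add_right : ∀ x y z : E, ip x (y + z) = ip x y + ip x z)
    (ip_smul_right : ∀ (a : 𝒜) (x y : E), ip x (a • y) = a * ip x y)
    (ip_conj : ∀ x y : E, star (ip x y) = ip y x)
    (ip_smul_left : ∀ (a : 𝒜) (x y : E), ip (a • x) y = star a * ip x y)
    (ip_nonneg : ∀ x : E, 0 ≤ ip x x)
    (ip_definite : ∀ x : E, ip x x = 0 → x = 0)
    (ip_norm : ∀ x : E, ‖x‖ = Real.sqrt ‖ip x x‖)
    (ξ : E) (hξ : IsUnit (ip ξ ξ)) (f : ℕ → E) (A B : ℝ) (hA : 0 < A) (hAB : A ≤ B)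
    (hframe : ∀ x : E, ∃ s : 𝒜,
      HasSum (fun i =>
        (ip x (f i) * ip ξ ξ - ip x ξ * ip ξ (f i)) *
          (ip (f i) x * ip ξ ξ - ip (f i) ξ * ip ξ x)) s ∧
      A • (ip x x * ip ξ ξ - ip x ξ * ip ξ x) ≤ s ∧
      s ≤ B • (ip x x * ip ξ ξ - ip x ξ * ip ξ x)) :
    ∃ C D : ℝ, 0 < C ∧ C ≤ D ∧
      ∀ x : E, ip ξ x = 0 → ∃ s : 𝒜,
        HasSum (fun i => ip x (f i) * ip (f i) x) s ∧
        C • ip x x ≤ s ∧ s ≤ D • ip x x := by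
  let _ : CommCStarAlgebra 𝒜 := {}
  obtain ⟨v, huv⟩ := hξ.exists_right_inv
  obtain ⟨hv, hlow, hupp⟩ := inverse_bounds_of_nonneg (ip_nonneg ξ) huv
  have hB : 0 < B := hA.trans_le hAB
  have mul_mono {a b c : 𝒜} (hab : a ≤ b) (hc : 0 ≤ c) : a * c ≤ b * c := by
    have h := Commute.mul_nonneg (sub_nonneg.2 hab) hc (Commute.all _ _)
    rwa [sub_mul, sub_nonneg] at h
  have hvv : 0 ≤ v * v := Commute.mul_nonneg hv hv (Commute.all _ _)
  have hC : 0 < A * (‖ip ξ ξ‖ + 1)⁻¹ := by positivity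
  refine ⟨A * (‖ip ξ ξ‖ + 1)⁻¹, max (A * (‖ip ξ ξ‖ + 1)⁻¹) (B * ‖v‖), hC, le_max_left _ _,
    fun x hx => ?_⟩
  have hx' : ip x ξ = 0 := by rw [← ip_conj, hx, star_zero]
  obtain ⟨s, hs, hAs, hsB⟩ := hframe x
  simp only [hx, hx', zero_mul, mul_zero, sub_zero] at hs hAs hsB
  have hcancel (c : ℝ) : c • (ip x x * ip ξ ξ) * (v * v) = c • (v * ip x x) := by
    rw [smul_mul_assoc]
    congr 1
    linear_combination (ip x x * v) * huv
  refine ⟨s * (v * v), ?_, ?_, ?_⟩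
  · have h := hs.mul_right (v * v)
    refine (funext fun i => ?_ : _ = fun i => ip x (f i) * ip (f i) x) ▸ h
    linear_combination ((ip x (f i) * ip (f i) x) * (ip ξ ξ * v + 1)) * huv
  · calc (A * (‖ip ξ ξ‖ + 1)⁻¹) • ip x x
        = A • ((‖ip ξ ξ‖ + 1)⁻¹ • (1 : 𝒜) * ip x x) := by
          rw [smul_mul_assoc, one_mul, mul_smul]
      _ ≤ A • (v * ip x x) :=
          smul_le_smul_of_nonneg_left (mul_mono hlow (ip_nonneg x)) hA.le
      _ ≤ s * (v * v) := by rw [← hcancel]; exact mul_mono hAs hvv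
  · calc s * (v * v) ≤ B • (v * ip x x) := by rw [← hcancel]; exact mul_mono hsB hvv
      _ ≤ B • (‖v‖ • (1 : 𝒜) * ip x x) :=
          smul_le_smul_of_nonneg_left (mul_mono hupp (ip_nonneg x)) hB.le
      _ = (B * ‖v‖) • ip x x := by rw [smul_mul_assoc, one_mul, mul_smul]
      _ ≤ max (A * (‖ip ξ ξ‖ + 1)⁻¹) (B * ‖v‖) • ip x x :=
          smul_le_smul_of_nonneg_right (le_max_right _ _) (ip_nonneg x)
end

section
/- Let ξ ∈ E and let (x_i)_{i∈ℕ} be an 𝒜-2-Bessel sequence associated to ξ with bound B > 0, i.e. for every y ∈ E the series Σ_i ⟨y,x_i|ξ⟩⟨x_i,y|ξ⟩ converges in 𝒜 and Σ_i ⟨y,x_i|ξ⟩⟨x_i,y|ξ⟩ ≤ B·⟨y,y|ξ⟩. Then for every n ∈ ℕ and all c₁,…,c_n ∈ 𝒜, writing u := Σ_{i=1}^{n} c_i•x_i, one has ‖⟨u,u|ξ⟩‖ ≤ B·‖Σ_{i=1}^{n} c_i c_i*‖; equivalently p(u,ξ)² ≤ B·‖Σ_{i=1}^{n} c_i c_i*‖.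 -/
section BesselBound

variable {A : Type*} [CommCStarAlgebra A] [PartialOrder A] [StarOrderedRing A]

/-- Cauchy–Schwarz inequality for finite families in a commutative C⋆-algebra. -/
theorem sum_mul_mul_star_le_smul_sum_mul_star {ι : Type*} (t : Finset ι) (c g : ι → A) {k : ℝ}
    (hk : 0 < k) (hc : ‖∑ i ∈ t, c i * star (c i)‖ ≤ k) :
    (∑ i ∈ t, c i * g i) * star (∑ i ∈ t, c i * g i) ≤ k • ∑ i ∈ t, g i * star (g i) := by
  set T := ∑ i ∈ t, c i * g i with hT
  set C := ∑ i ∈ t, c i * star (c i) with hC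
  set S := ∑ i ∈ t, g i * star (g i) with hS
  have hsq : 0 ≤ ∑ i ∈ t, (k • g i - T * star (c i)) * star (k • g i - T * star (c i)) :=
    Finset.sum_nonneg fun i _ => mul_star_self_nonneg _
  have hexp : ∑ i ∈ t, (k • g i - T * star (c i)) * star (k • g i - T * star (c i)) =
      k • k • S - k • (T * star T) - k • (T * star T) + T * C * star T := by
    have hT' : star T = ∑ i ∈ t, star (c i) * star (g i) := by
      simp [hT, star_sum]
    calc _ = ∑ i ∈ t, (k • k • (g i * star (g i)) - k • (star T * (c i * g i))
            - k • (T * (star (c i) * star (g i))) + T * star T * (c i * star (c i))) := by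
          refine Finset.sum_congr rfl fun i _ => ?_
          rw [star_sub, star_smul, star_trivial k, star_mul, star_star]
          simp only [Algebra.smul_def]
          ring
      _ = k • k • S - k • (star T * T) - k • (T * star T) + T * star T * C := by
          simp only [Finset.sum_add_distrib, Finset.sum_sub_distrib, ← Finset.smul_sum,
            ← Finset.mul_sum, ← hT, ← hT', ← hC, ← hS]
      _ = _ := by rw [mul_comm (star T) T, mul_right_comm]
  have hCnonneg : 0 ≤ C := Finset.sum_nonneg fun i _ => mul_star_self_nonneg _
  have hconj : T * C * star T ≤ k • (T * star T) :=
    (CStarAlgebra.star_right_conjugate_le_norm_smul (hb := hCnonneg.isSelfAdjoint)).trans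
      (smul_le_smul_of_nonneg_right hc (mul_star_self_nonneg T))
  have hmul : k • (T * star T) ≤ k • k • S := by
    rw [hexp] at hsq
    have := hsq.trans (add_le_add_right hconj _)
    rwa [sub_add_cancel, sub_nonneg] at this
  exact (smul_le_smul_iff_of_pos_left hk).mp hmul

/-- A synthesis bound from a Bessel-type inequality in a commutative C⋆-algebra. -/
theorem norm_sum_mul_le_of_sum_mul_star_le {ι : Type*} (t : Finset ι) (c g : ι → A) {B : ℝ}
    (hB : 0 ≤ B) (h : ∑ i ∈ t, g i * star (g i) ≤ B • ∑ i ∈ t, c i * g i) :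
    ‖∑ i ∈ t, c i * g i‖ ≤ B * ‖∑ i ∈ t, c i * star (c i)‖ := by
  set T := ∑ i ∈ t, c i * g i with hT
  set C := ∑ i ∈ t, c i * star (c i) with hC
  have key : ∀ k : ℝ, ‖C‖ < k → ‖T‖ ≤ B * k := fun k hk => by
    have hk0 : 0 < k := (norm_nonneg C).trans_lt hk
    have hle : T * star T ≤ k • B • T :=
      (sum_mul_mul_star_le_smul_sum_mul_star t c g hk0 hk.le).trans
        (smul_le_smul_of_nonneg_left h hk0.le)
    have hnorm := CStarAlgebra.norm_le_norm_of_nonneg_of_le (mul_star_self_nonneg T) hle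
    rw [CStarRing.norm_self_mul_star, norm_smul, norm_smul, Real.norm_of_nonneg hk0.le,
      Real.norm_of_nonneg hB] at hnorm
    rcases (norm_nonneg T).eq_or_lt with h0 | h0
    · rw [← h0]; positivity
    · exact le_of_mul_le_mul_right (by linarith) h0
  refine ge_of_tendsto (x := nhdsWithin ‖C‖ (Set.Ioi ‖C‖)) (f := fun k => B * k) ?_ ?_
  · exact (Continuous.tendsto (by fun_prop) _).mono_left nhdsWithin_le_nhds
  · filter_upwards [self_mem_nhdsWithin] with k hk using key k hk

end BesselBound

/- Setting: 𝒜 a commutative unital C*-algebra, E a Hilbert 𝒜-module with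
𝒜-valued inner product `ip`, which is 𝒜-linear in the second variable,
conjugate-symmetric, positive and definite, with compatible norm.
The standard 𝒜-2-inner product is ⟨x,y|z⟩ = ip x y * ip z z - ip x z * ip z y. -/
theorem stmt_9
    {𝒜 : Type*} [NormedCommRing 𝒜] [StarRing 𝒜] [CStarRing 𝒜]
    [NormedAlgebra ℂ 𝒜] [StarModule ℂ 𝒜] [PartialOrder 𝒜] [StarOrderedRing 𝒜]
    [CompleteSpace 𝒜]
    {E : Type*} [NormedAddCommGroup E] [Module 𝒜 E] [CompleteSpace E]
    (ip : E → E → 𝒜)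
    (ip_add_right : ∀ x y z : E, ip x (y + z) = ip x y + ip x z)
    (ip_smul_right : ∀ (a : 𝒜) (x y : E), ip x (a • y) = a * ip x y)
    (ip_conj : ∀ x y : E, star (ip x y) = ip y x)
    (ip_smul_left : ∀ (a : 𝒜) (x y : E), ip (a • x) y = star a * ip x y)
    (ip_nonneg : ∀ x : E, 0 ≤ ip x x)
    (ip_definite : ∀ x : E, ip x x = 0 → x = 0)
    (ip_norm : ∀ x : E, ‖x‖ = Real.sqrt ‖ip x x‖)
    (ξ : E) (B : ℝ) (hB : 0 < B) (f : ℕ → E)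
    (hbessel : ∀ y : E, ∃ s : 𝒜,
      HasSum (fun i =>
        (ip y (f i) * ip ξ ξ - ip y ξ * ip ξ (f i)) *
          (ip (f i) y * ip ξ ξ - ip (f i) ξ * ip ξ y)) s ∧
      s ≤ B • (ip y y * ip ξ ξ - ip y ξ * ip ξ y)) :
    ∀ (n : ℕ) (c : ℕ → 𝒜) (u : E), u = ∑ i ∈ Finset.range n, c i • f i →
      ‖ip u u * ip ξ ξ - ip u ξ * ip ξ u‖ ≤ B * ‖∑ i ∈ Finset.range n, c i * star (c i)‖ := by
  let _ : CommCStarAlgebra 𝒜 := { }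
  rintro n c u hu
  have ip_zero_right : ∀ x, ip x 0 = 0 := fun x => by simpa using ip_smul_right 0 x 0
  have ip_sum_right : ∀ x, ip x u = ∑ i ∈ Finset.range n, c i * ip x (f i) := fun x => by
    let φ : E →+ 𝒜 := ⟨⟨ip x, ip_zero_right x⟩, ip_add_right x⟩
    rw [hu]
    exact (map_sum φ _ _).trans (Finset.sum_congr rfl fun i _ => ip_smul_right _ _ _)
  let g : ℕ → 𝒜 := fun i => ip u (f i) * ip ξ ξ - ip u ξ * ip ξ (f i)
  have hstar : ∀ i, star (g i) = ip (f i) u * ip ξ ξ - ip (f i) ξ * ip ξ u := fun i => by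
    simp only [g, star_sub, star_mul, ip_conj, mul_comm]
  have hT : ip u u * ip ξ ξ - ip u ξ * ip ξ u = ∑ i ∈ Finset.range n, c i * g i := by
    rw [ip_sum_right u, ip_sum_right ξ, Finset.sum_mul, Finset.mul_sum, ← Finset.sum_sub_distrib]
    exact Finset.sum_congr rfl fun i _ => by simp only [g]; ring
  obtain ⟨s, hs, hsB⟩ := hbessel u
  rw [hT] at hsB ⊢
  simp only [← hstar] at hs
  refine norm_sum_mul_le_of_sum_mul_star_le _ c g hB.le (le_trans ?_ hsB)
  exact sum_le_hasSum _ (fun i _ => mul_star_self_nonneg (g i)) hs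
end
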